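/- Assume τ is a regular element, i.e. V_reg^τ ≠ ∅. Let (v, v*) ∈ V_reg × V* be a pair whose W-orbit (for the diagonal action of W on V × V*) is stable under τ. Then there exists w ∈ W such that w(v) is fixed by τ and w(v*) is fixed by τ. -/

import Mathlib

open Module

noncomputable section

variable {V : Type*} [AddCommGroup V] [Module ℂ V] [FiniteDimensional ℂ V]

/-- `g` is a reflection: its fixed-point subspace has codimension 1. -/
def IsReflection (g : V ≃ₗ[ℂ] V) : Prop :=
  finrank ℂ (LinearMap.ker ((g : V →ₗ[ℂ] V) - LinearMap.id)) + 1 = finrank ℂ V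

/-- The set of points of `V` with trivial stabilizer in `W`. -/
def VReg (W : Subgroup (V ≃ₗ[ℂ] V)) : Set V :=
  {v | ∀ w ∈ W, w v = v → w = 1}

/-- The contragredient action of `g` on the dual space: `(g · x)(v) = x(g⁻¹ v)`. -/
def dAct (g : V ≃ₗ[ℂ] V) (x : Module.Dual ℂ V) : Module.Dual ℂ V :=
  x ∘ₗ (g.symm : V →ₗ[ℂ] V)

/-- The diagonal action of `g` on `V × V*`. -/
def pAct (g : V ≃ₗ[ℂ] V) (p : V × Module.Dual ℂ V) : V × Module.Dual ℂ V :=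
  (g p.1, dAct g p.2)

open MvPolynomial

section Pullback

variable {E : Type*} [AddCommGroup E] [Module ℂ E] {ι : Type*}

theorem eq_of_apply_eq_of_mem_VReg {W : Subgroup (E ≃ₗ[ℂ] E)} {v : E} (hv : v ∈ VReg W)
    {w w' : W} (h : (w : E ≃ₗ[ℂ] E) v = (w' : E ≃ₗ[ℂ] E) v) : w = w' := by
  refine (inv_mul_eq_one.1 (Subtype.ext (hv _ (w'⁻¹ * w).2 ?_))).symm
  change ((w' : E ≃ₗ[ℂ] E)⁻¹ * (w : E ≃ₗ[ℂ] E)) v = v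
  rw [LinearEquiv.mul_apply, h, ← LinearEquiv.mul_apply, inv_mul_cancel]
  rfl

/-- Evaluation of a polynomial in the coordinates of the basis `β` at a vector. -/
def evalAt (β : Basis ι ℂ E) (x : E) : MvPolynomial ι ℂ →ₐ[ℂ] ℂ :=
  aeval fun i => β.repr x i

theorem evalAt_X (β : Basis ι ℂ E) (x : E) (i : ι) : evalAt β x (X i) = β.repr x i := by
  simp [evalAt]

theorem evalAt_C (β : Basis ι ℂ E) (x : E) (c : ℂ) : evalAt β x (C c) = c := by
  simp [evalAt]

/-- Restriction of polynomials to the `W`-orbit of `v`. -/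
def orbitEval (β : Basis ι ℂ E) (W : Subgroup (E ≃ₗ[ℂ] E)) (v : E) :
    MvPolynomial ι ℂ →ₗ[ℂ] (W → ℂ) :=
  LinearMap.pi fun w => (evalAt β ((w : E ≃ₗ[ℂ] E) v)).toLinearMap

theorem orbitEval_apply (β : Basis ι ℂ E) (W : Subgroup (E ≃ₗ[ℂ] E)) (v : E)
    (P : MvPolynomial ι ℂ) (w : W) :
    orbitEval β W v P w = evalAt β ((w : E ≃ₗ[ℂ] E) v) P := rfl

theorem orbitEval_surjective (β : Basis ι ℂ E) {W : Subgroup (E ≃ₗ[ℂ] E)} [Fintype W] {v : E}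
    (hv : v ∈ VReg W) : Function.Surjective (orbitEval β W v) := by
  classical
  have hsep (w w' : W) (hne : w ≠ w') : ∃ q : MvPolynomial ι ℂ,
      evalAt β ((w : E ≃ₗ[ℂ] E) v) q = 1 ∧ evalAt β ((w' : E ≃ₗ[ℂ] E) v) q = 0 := by
    have hx : (w : E ≃ₗ[ℂ] E) v ≠ (w' : E ≃ₗ[ℂ] E) v :=
      mt (eq_of_apply_eq_of_mem_VReg hv) hne
    obtain ⟨i, hi⟩ := not_forall.1 (mt Finsupp.ext (β.repr.injective.ne hx))
    refine ⟨C (β.repr ((w : E ≃ₗ[ℂ] E) v) i - β.repr ((w' : E ≃ₗ[ℂ] E) v) i)⁻¹ *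
      (X i - C (β.repr ((w' : E ≃ₗ[ℂ] E) v) i)), ?_, ?_⟩
    · simp only [map_mul, map_sub, evalAt_C, evalAt_X]
      exact inv_mul_cancel₀ (sub_ne_zero.2 hi)
    · simp only [map_mul, map_sub, evalAt_C, evalAt_X, sub_self, mul_zero]
  rw [← LinearMap.range_eq_top, eq_top_iff, ← (Pi.basisFun ℂ W).span_eq, Submodule.span_le]
  rintro _ ⟨w, rfl⟩
  choose! q hq using hsep w
  refine ⟨∏ w' ∈ Finset.univ.erase w, q w', funext fun x => ?_⟩
  rw [orbitEval_apply, map_prod, Pi.basisFun_apply]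
  rcases eq_or_ne x w with rfl | hx
  · rw [Pi.single_eq_same]
    exact Finset.prod_eq_one fun w' hw' => (hq w' (Finset.ne_of_mem_erase hw').symm).1
  · rw [Pi.single_eq_of_ne hx]
    exact Finset.prod_eq_zero (Finset.mem_erase.2 ⟨hx, Finset.mem_univ x⟩) (hq x hx.symm).2

theorem homogeneousComponent_mul_of_isHomogeneous {a : MvPolynomial ι ℂ} {i : ℕ}
    (ha : a.IsHomogeneous i) (n : ℕ) (b : MvPolynomial ι ℂ) :
    homogeneousComponent n (a * b) =
      if i ≤ n then a * homogeneousComponent (n - i) b else 0 := by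
  conv_lhs => rw [← sum_homogeneousComponent b, Finset.mul_sum, map_sum]
  have h (k : ℕ) : homogeneousComponent n (a * homogeneousComponent k b) =
      if n = i + k then a * homogeneousComponent k b else 0 :=
    homogeneousComponent_of_mem (ha.mul (homogeneousComponent_isHomogeneous k b))
  simp only [h]
  split_ifs with hi
  · obtain ⟨m, rfl⟩ := Nat.exists_eq_add_of_le hi
    simp only [add_right_inj, Finset.sum_ite_eq, add_tsub_cancel_left]
    split_ifs with hm
    · rfl
    · rw [homogeneousComponent_eq_zero _ _ (by simpa using hm), mul_zero]
  · exact Finset.sum_eq_zero fun k _ => if_neg (by omega)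

variable [Fintype ι]

/-- Precomposition of polynomials, in the coordinates of the basis `β`, with `g`. -/
def pullback (β : Basis ι ℂ E) (g : E ≃ₗ[ℂ] E) : MvPolynomial ι ℂ →ₐ[ℂ] MvPolynomial ι ℂ :=
  aeval fun i => ∑ j, C (β.repr (g (β j)) i) * X j

theorem pullback_X (β : Basis ι ℂ E) (g : E ≃ₗ[ℂ] E) (i : ι) :
    pullback β g (X i) = ∑ j, C (β.repr (g (β j)) i) * X j := by
  simp [pullback]

theorem evalAt_pullback (β : Basis ι ℂ E) (g : E ≃ₗ[ℂ] E) (x : E) (P : MvPolynomial ι ℂ) :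
    evalAt β x (pullback β g P) = evalAt β (g x) P := by
  have : (evalAt β x).comp (pullback β g) = evalAt β (g x) := by
    refine MvPolynomial.algHom_ext fun i => ?_
    rw [AlgHom.comp_apply, pullback_X, map_sum, evalAt_X]
    simp only [map_mul, evalAt_C, evalAt_X]
    conv_rhs => rw [← β.sum_repr x]
    simp only [map_sum, map_smul, Finsupp.coe_finsetSum, Finset.sum_apply, Finsupp.smul_apply,
      smul_eq_mul, mul_comm]
  exact DFunLike.congr_fun this P

theorem eq_of_evalAt_eq (β : Basis ι ℂ E) {P Q : MvPolynomial ι ℂ}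
    (h : ∀ x, evalAt β x P = evalAt β x Q) : P = Q := by
  refine MvPolynomial.funext fun y => ?_
  have := h (β.equivFun.symm y)
  have hy : (fun i => β.repr (β.equivFun.symm y) i) = y := by
    ext i
    rw [← Basis.equivFun_apply, LinearEquiv.apply_symm_apply]
  simp only [evalAt, hy] at this
  simpa [MvPolynomial.coe_aeval_eq_eval] using this

theorem pullback_mul (β : Basis ι ℂ E) (g h : E ≃ₗ[ℂ] E) (P : MvPolynomial ι ℂ) :
    pullback β (g * h) P = pullback β h (pullback β g P) :=
  eq_of_evalAt_eq β fun x => by simp only [evalAt_pullback, LinearEquiv.mul_apply]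

theorem pullback_one (β : Basis ι ℂ E) (P : MvPolynomial ι ℂ) : pullback β 1 P = P :=
  eq_of_evalAt_eq β fun x => by simp only [evalAt_pullback, LinearEquiv.coe_one, id]

theorem pullback_injective (β : Basis ι ℂ E) (g : E ≃ₗ[ℂ] E) :
    Function.Injective (pullback β g) :=
  Function.LeftInverse.injective (g := pullback β g⁻¹) fun P => by
    rw [← pullback_mul, mul_inv_cancel, pullback_one]

theorem MvPolynomial.IsHomogeneous.pullback (β : Basis ι ℂ E) (g : E ≃ₗ[ℂ] E)
    {P : MvPolynomial ι ℂ} {n : ℕ} (hP : P.IsHomogeneous n) :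
    (pullback β g P).IsHomogeneous n := by
  have := hP.aeval (fun i => ∑ j, C (β.repr (g (β j)) i) * X j)
    (n := 1) fun i => IsHomogeneous.sum _ _ _ fun j _ => isHomogeneous_C_mul_X _ j
  rwa [one_mul] at this

theorem homogeneousComponent_pullback (β : Basis ι ℂ E) (g : E ≃ₗ[ℂ] E)
    (P : MvPolynomial ι ℂ) (n : ℕ) :
    homogeneousComponent n (pullback β g P) = pullback β g (homogeneousComponent n P) := by
  conv_lhs => rw [← sum_homogeneousComponent P, map_sum, map_sum]
  have h (i : ℕ) : homogeneousComponent n (pullback β g (homogeneousComponent i P)) =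
      if i = n then pullback β g (homogeneousComponent n P) else 0 := by
    rw [homogeneousComponent_of_mem
      ((homogeneousComponent_isHomogeneous i P).pullback β g)]
    aesop
  simp only [h]
  rw [Finset.sum_ite_eq']
  split_ifs with hn
  · rfl
  · rw [homogeneousComponent_eq_zero, map_zero]
    simpa using hn

/-- The polynomials, in the coordinates of the basis `β`, that are invariant under `W`. -/
def invariantPoly (β : Basis ι ℂ E) (W : Subgroup (E ≃ₗ[ℂ] E)) :
    Subalgebra ℂ (MvPolynomial ι ℂ) where
  carrier := {P | ∀ g ∈ W, pullback β g P = P}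
  mul_mem' ha hb g hg := by rw [map_mul, ha g hg, hb g hg]
  add_mem' ha hb g hg := by rw [map_add, ha g hg, hb g hg]
  algebraMap_mem' c g _ := (pullback β g).commutes c

theorem homogeneousComponent_mem_invariantPoly {β : Basis ι ℂ E} {W : Subgroup (E ≃ₗ[ℂ] E)}
    {P : MvPolynomial ι ℂ} (hP : P ∈ invariantPoly β W) (n : ℕ) :
    homogeneousComponent n P ∈ invariantPoly β W := fun g hg => by
  rw [← homogeneousComponent_pullback, hP g hg]

/-- The ideal generated by the invariants without constant term. -/
def hilbertIdeal (β : Basis ι ℂ E) (W : Subgroup (E ≃ₗ[ℂ] E)) : Ideal (MvPolynomial ι ℂ) :=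
  Ideal.span {P | P ∈ invariantPoly β W ∧ constantCoeff P = 0}

/-- The sum of the translates of a polynomial by the elements of `W`. -/
def orbitSum (β : Basis ι ℂ E) (W : Subgroup (E ≃ₗ[ℂ] E)) [Fintype W] :
    MvPolynomial ι ℂ →ₗ[ℂ] MvPolynomial ι ℂ :=
  ∑ g : W, (pullback β (g : E ≃ₗ[ℂ] E)).toLinearMap

theorem orbitSum_apply (β : Basis ι ℂ E) (W : Subgroup (E ≃ₗ[ℂ] E)) [Fintype W]
    (P : MvPolynomial ι ℂ) :
    orbitSum β W P = ∑ g : W, pullback β (g : E ≃ₗ[ℂ] E) P := by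
  simp [orbitSum]

theorem orbitSum_mem (β : Basis ι ℂ E) (W : Subgroup (E ≃ₗ[ℂ] E)) [Fintype W]
    (P : MvPolynomial ι ℂ) : orbitSum β W P ∈ invariantPoly β W := fun g hg => by
  simp only [orbitSum_apply, map_sum, ← pullback_mul]
  exact Fintype.sum_equiv (Equiv.mulRight (⟨g, hg⟩ : W)) _ _ fun _ => rfl

theorem orbitSum_mul {β : Basis ι ℂ E} {W : Subgroup (E ≃ₗ[ℂ] E)} [Fintype W]
    {U : MvPolynomial ι ℂ} (hU : U ∈ invariantPoly β W) (P : MvPolynomial ι ℂ) :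
    orbitSum β W (U * P) = U * orbitSum β W P := by
  simp only [orbitSum_apply, Finset.mul_sum, map_mul]
  exact Finset.sum_congr rfl fun g _ => by rw [hU g g.2]

theorem pullback_mem_hilbertIdeal {β : Basis ι ℂ E} {W : Subgroup (E ≃ₗ[ℂ] E)}
    {g : E ≃ₗ[ℂ] E} (hg : g ∈ W) {P : MvPolynomial ι ℂ} (hP : P ∈ hilbertIdeal β W) :
    pullback β g P ∈ hilbertIdeal β W := by
  suffices hilbertIdeal β W ≤ (hilbertIdeal β W).comap (pullback β g) from this hP
  refine Ideal.span_le.2 fun a ha => ?_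
  change pullback β g a ∈ hilbertIdeal β W
  rw [ha.1 g hg]
  exact Ideal.subset_span ha

/-- The polynomials moved by a reflection by a multiple of the form defining its hyperplane. -/
theorem IsReflection.exists_dvd_sub_pullback (β : Basis ι ℂ E) {g : E ≃ₗ[ℂ] E}
    (hg : IsReflection g) :
    ∃ L : MvPolynomial ι ℂ, L.IsHomogeneous 1 ∧ L ≠ 0 ∧ ∀ P, L ∣ P - pullback β g P := by
  set f : E →ₗ[ℂ] E := (g : E →ₗ[ℂ] E) - LinearMap.id with hf
  have := Module.Finite.of_basis β
  have hr : finrank ℂ (LinearMap.range f) = 1 := by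
    have h₁ := f.finrank_range_add_finrank_ker
    have h₂ : finrank ℂ (LinearMap.ker f) + 1 = finrank ℂ E := hg
    omega
  obtain ⟨⟨u, hu⟩, hu0, hc⟩ := finrank_eq_one_iff'.1 hr
  choose c hc using fun j => hc ⟨f (β j), LinearMap.mem_range_self f _⟩
  replace hc (j : ι) : f (β j) = c j • u := (congrArg Subtype.val (hc j)).symm
  refine ⟨∑ j, C (c j) * X j, IsHomogeneous.sum _ _ _ fun j _ => isHomogeneous_C_mul_X _ j,
    fun h0 => ?_, fun P => ?_⟩
  · have hc0 (j : ι) : c j = 0 := by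
      classical
      have := congrArg (evalAt β (β j)) h0
      simpa [evalAt_X, evalAt_C, Finsupp.single_apply] using this
    have : f = 0 := β.ext fun j => by simp [hc, hc0]
    rw [this, LinearMap.range_zero, finrank_bot] at hr
    exact zero_ne_one hr
  · set L : MvPolynomial ι ℂ := ∑ j, C (c j) * X j with hL
    have key : ((Ideal.Quotient.mkₐ ℂ (Ideal.span {L})).comp (pullback β g)) =
        Ideal.Quotient.mkₐ ℂ (Ideal.span {L}) := by
      refine MvPolynomial.algHom_ext fun i => Ideal.Quotient.eq.2 ?_
      refine Ideal.mem_span_singleton'.2 ⟨C (β.repr u i), ?_⟩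
      refine eq_of_evalAt_eq β fun x => ?_
      have hx : f x = (evalAt β x L) • u := by
        conv_lhs => rw [← β.sum_repr x]
        simp only [map_sum, map_smul, hc, hL, map_mul, evalAt_C, evalAt_X, Finset.sum_smul,
          smul_smul, mul_comm]
      have hgx : g x = f x + x := by simp [hf]
      have he : evalAt β x (pullback β g (X i)) = β.repr (g x) i := by
        rw [evalAt_pullback, evalAt_X]
      change _ = evalAt β x (pullback β g (X i) - X i)
      rw [map_sub, he, hgx, hx, map_mul, evalAt_C, evalAt_X]
      simp [mul_comm]
    refine Ideal.mem_span_singleton.1 (Ideal.Quotient.eq.1 ?_)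
    exact (DFunLike.congr_fun key P).symm

theorem sub_pullback_mem_hilbertIdeal {β : Basis ι ℂ E} {W : Subgroup (E ≃ₗ[ℂ] E)}
    {T : Set (E ≃ₗ[ℂ] E)} (hT : Subgroup.closure T = W) {P : MvPolynomial ι ℂ}
    (hP : ∀ g ∈ T, P - pullback β g P ∈ hilbertIdeal β W) {g : E ≃ₗ[ℂ] E} (hg : g ∈ W) :
    P - pullback β g P ∈ hilbertIdeal β W := by
  rw [← hT] at hg
  induction hg using Subgroup.closure_induction with
  | mem g hg => exact hP g hg
  | one => simp [pullback_one]
  | mul g h _ hh ihg ihh =>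
    have := add_mem ihh (pullback_mem_hilbertIdeal (hT ▸ hh) ihg)
    rwa [map_sub, ← pullback_mul, sub_add_sub_cancel] at this
  | inv g hg ih =>
    have := neg_mem (pullback_mem_hilbertIdeal (hT ▸ inv_mem hg) ih)
    rwa [map_sub, ← pullback_mul, mul_inv_cancel, pullback_one, neg_sub] at this

theorem orbitSum_C (β : Basis ι ℂ E) (W : Subgroup (E ≃ₗ[ℂ] E)) [Fintype W] (c : ℂ) :
    orbitSum β W (C c) = C (Fintype.card W * c) := by
  simp [orbitSum_apply]

theorem orbitSum_of_mem {β : Basis ι ℂ E} {W : Subgroup (E ≃ₗ[ℂ] E)} [Fintype W]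
    {U : MvPolynomial ι ℂ} (hU : U ∈ invariantPoly β W) :
    orbitSum β W U = C (Fintype.card W : ℂ) * U := by
  rw [← mul_one U, orbitSum_mul hU, ← C_1, orbitSum_C, mul_one, mul_comm, C_1, mul_one]

/-- Chevalley's lemma on relations between invariants of a reflection group. -/
theorem mem_hilbertIdeal_or_exists_eq_sum {β : Basis ι ℂ E} {W : Subgroup (E ≃ₗ[ℂ] E)}
    [Fintype W] (hW : Subgroup.closure {g : E ≃ₗ[ℂ] E | g ∈ W ∧ IsReflection g} = W)
    {κ : Type*} (F : Finset κ) {U₀ : MvPolynomial ι ℂ} {U : κ → MvPolynomial ι ℂ}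
    (hU₀ : U₀ ∈ invariantPoly β W) (hU : ∀ i, U i ∈ invariantPoly β W) (n : ℕ)
    (P₀ : MvPolynomial ι ℂ) (P : κ → MvPolynomial ι ℂ) (hP₀ : P₀.IsHomogeneous n)
    (hsum : U₀ * P₀ + ∑ i ∈ F, U i * P i = 0) :
    P₀ ∈ hilbertIdeal β W ∨
      ∃ c : κ → MvPolynomial ι ℂ, (∀ i, c i ∈ invariantPoly β W) ∧
        U₀ = ∑ i ∈ F, U i * c i := by
  have hN : (Fintype.card W : ℂ) ≠ 0 := Nat.cast_ne_zero.2 Fintype.card_ne_zero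
  induction n generalizing P₀ P with
  | zero =>
    have h₀ : P₀ = C (coeff 0 P₀) := by
      rw [← homogeneousComponent_zero, homogeneousComponent_eq_self hP₀]
    generalize coeff 0 P₀ = a at h₀
    subst h₀
    rcases eq_or_ne a 0 with rfl | ha
    · left
      simp
    right
    have hna : (Fintype.card W : ℂ) * a ≠ 0 := mul_ne_zero hN ha
    refine ⟨fun i => C (-((Fintype.card W : ℂ) * a)⁻¹) * orbitSum β W (P i),
      fun i => mul_mem ((invariantPoly β W).algebraMap_mem _) (orbitSum_mem _ _ _), ?_⟩
    have h := congrArg (orbitSum β W) hsum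
    rw [map_add, map_sum, map_zero, orbitSum_mul hU₀, orbitSum_C] at h
    simp only [orbitSum_mul (hU _)] at h
    simp only [mul_left_comm (U _), ← Finset.mul_sum]
    rw [eq_neg_of_add_eq_zero_right h, C_neg, neg_mul_neg, mul_left_comm, ← C_mul,
      inv_mul_cancel₀ hna, C_1, mul_one]
  | succ n ih =>
    by_cases hc : ∃ c : κ → MvPolynomial ι ℂ, (∀ i, c i ∈ invariantPoly β W) ∧
        U₀ = ∑ i ∈ F, U i * c i
    · exact Or.inr hc
    left
    have hmem (g : E ≃ₗ[ℂ] E) (hg : g ∈ W) : P₀ - pullback β g P₀ ∈ hilbertIdeal β W := by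
      refine sub_pullback_mem_hilbertIdeal hW ?_ hg
      rintro s ⟨hsW, hs⟩
      obtain ⟨L, hL1, hL0, hL⟩ := hs.exists_dvd_sub_pullback β
      obtain ⟨Q₀, hQ₀⟩ := hL P₀
      choose Q hQ using fun i => hL (P i)
      have hhom : Q₀.IsHomogeneous n := by
        have h₁ : homogeneousComponent (n + 1) (L * Q₀) = L * Q₀ := by
          rw [← hQ₀]
          exact homogeneousComponent_eq_self (hP₀.sub (hP₀.pullback β s))
        rw [homogeneousComponent_mul_of_isHomogeneous hL1, if_pos (by omega),
          Nat.add_sub_cancel] at h₁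
        rw [← mul_left_cancel₀ hL0 h₁]
        exact homogeneousComponent_isHomogeneous _ _
      have hrel : U₀ * Q₀ + ∑ i ∈ F, U i * Q i = 0 := by
        refine mul_left_cancel₀ hL0 ?_
        have h₂ := congrArg (pullback β s) hsum
        simp only [map_add, map_sum, map_mul, map_zero, hU₀ s hsW, hU _ s hsW] at h₂
        rw [mul_zero, mul_add, Finset.mul_sum]
        simp only [mul_left_comm L, ← hQ₀, ← hQ, mul_sub, Finset.sum_sub_distrib]
        linear_combination hsum - h₂
      rw [hQ₀]
      exact Ideal.mul_mem_left _ _ ((ih Q₀ Q hhom hrel).resolve_right hc)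
    have hsub : C (Fintype.card W : ℂ) * P₀ - orbitSum β W P₀ ∈ hilbertIdeal β W := by
      have : C (Fintype.card W : ℂ) * P₀ - orbitSum β W P₀ =
          ∑ g : W, (P₀ - pullback β (g : E ≃ₗ[ℂ] E) P₀) := by
        simp [orbitSum_apply, Finset.sum_sub_distrib]
      rw [this]
      exact Ideal.sum_mem _ fun g _ => hmem g g.2
    have horb : orbitSum β W P₀ ∈ hilbertIdeal β W := by
      refine Ideal.subset_span ⟨orbitSum_mem _ _ _, ?_⟩
      have : (orbitSum β W P₀).IsHomogeneous (n + 1) := by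
        rw [orbitSum_apply]
        exact IsHomogeneous.sum _ _ _ fun g _ => hP₀.pullback β _
      rw [constantCoeff_eq]
      exact this.coeff_eq_zero (by simp)
    have := Ideal.mul_mem_left _ (C (Fintype.card W : ℂ)⁻¹) (add_mem hsub horb)
    rwa [sub_add_cancel, ← mul_assoc, ← C_mul, inv_mul_cancel₀ hN, C_1, one_mul] at this

theorem eq_zero_of_sum_mul_eq_zero_of_isHomogeneous {β : Basis ι ℂ E}
    {W : Subgroup (E ≃ₗ[ℂ] E)} [Fintype W]
    (hW : Subgroup.closure {g : E ≃ₗ[ℂ] E | g ∈ W ∧ IsReflection g} = W)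
    {κ : Type*} [DecidableEq κ] (F : Finset κ) (d : κ → ℕ) (n : ℕ) (h : κ → MvPolynomial ι ℂ)
    (hh : ∀ i ∈ F, (h i).IsHomogeneous (d i))
    (hind : ∀ c : κ → ℂ, ∑ i ∈ F, C (c i) * h i ∈ hilbertIdeal β W → ∀ i ∈ F, c i = 0)
    (U : κ → MvPolynomial ι ℂ) (hU : ∀ i, U i ∈ invariantPoly β W)
    (hUh : ∀ i ∈ F, (U i).IsHomogeneous (n - d i)) (hU0 : ∀ i ∈ F, n < d i → U i = 0)
    (hsum : ∑ i ∈ F, U i * h i = 0) : ∀ i ∈ F, U i = 0 := by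
  induction F using Finset.induction_on_max_value d generalizing h with
  | empty => simp
  | insert a F ha hmax ih =>
    rw [Finset.sum_insert ha] at hsum
    have haF (i : κ) (hi : i ∈ F) : i ≠ a := fun e => ha (e ▸ hi)
    have hinsert (c : κ → ℂ) (z : ℂ) :
        ∑ i ∈ insert a F, C (Function.update c a z i) * h i =
          C z * h a + ∑ i ∈ F, C (c i) * h i := by
      rw [Finset.sum_insert ha, Function.update_self]
      congr 1
      exact Finset.sum_congr rfl fun i hi => by rw [Function.update_of_ne (haF i hi)]
    obtain ⟨c, hcU, hcd⟩ : ∃ c : κ → ℂ, U a = ∑ i ∈ F, U i * C (c i) ∧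
        ∀ i, c i ≠ 0 → d i = d a := by
      rcases lt_or_ge n (d a) with hn | hn
      · exact ⟨0, by simp [hU0 a (Finset.mem_insert_self a F) hn], by simp⟩
      rcases mem_hilbertIdeal_or_exists_eq_sum hW F (hU a) hU (d a) (h a) h
        (hh a (Finset.mem_insert_self a F)) hsum with hI | ⟨c, -, hcU⟩
      · have := hind (Function.update 0 a 1) (by rw [hinsert]; simpa using hI) a
          (Finset.mem_insert_self a F)
        simp at this
      refine ⟨fun i => if d i = d a then coeff 0 (c i) else 0, ?_, fun i hi => ?_⟩
      · rw [← homogeneousComponent_eq_self (hUh a (Finset.mem_insert_self a F)), hcU, map_sum]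
        refine Finset.sum_congr rfl fun i hi => ?_
        rw [homogeneousComponent_mul_of_isHomogeneous (hUh i (Finset.mem_insert_of_mem hi))]
        have := hmax i hi
        beta_reduce
        rcases this.eq_or_lt with he | hlt
        · rw [if_pos he, he, if_pos le_rfl, Nat.sub_self, homogeneousComponent_zero]
        · rw [if_neg hlt.ne, if_neg (by omega), C_0, mul_zero]
      · by_contra hne
        exact hi (if_neg hne)
    have key : ∀ i ∈ F, U i = 0 := by
      refine ih (fun i => h i + C (c i) * h a) (fun i hi => ?_) (fun e he => ?_)
        (fun i hi => hUh i (Finset.mem_insert_of_mem hi))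
        (fun i hi => hU0 i (Finset.mem_insert_of_mem hi)) ?_
      · refine (hh i (Finset.mem_insert_of_mem hi)).add ?_
        rcases eq_or_ne (c i) 0 with h0 | h0
        · rw [h0, C_0, zero_mul]
          exact isHomogeneous_zero _ _ _
        · rw [hcd i h0]
          exact (hh a (Finset.mem_insert_self a F)).C_mul _
      · intro i hi
        have := hind (Function.update e a (∑ i ∈ F, e i * c i)) (by
          rw [hinsert]
          convert he using 1
          simp only [map_sum, map_mul, Finset.sum_mul, mul_add, Finset.sum_add_distrib, mul_assoc,
            add_comm]) i (Finset.mem_insert_of_mem hi)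
        rwa [Function.update_of_ne (haF i hi)] at this
      · rw [hcU, Finset.sum_mul] at hsum
        simp only [mul_add, Finset.sum_add_distrib, ← mul_assoc]
        rwa [add_comm]
    intro i hi
    rcases Finset.mem_insert.1 hi with rfl | hi
    · rw [hcU]
      exact Finset.sum_eq_zero fun j hj => by rw [key j hj, zero_mul]
    · exact key i hi

/-- Homogeneous polynomials independent modulo the Hilbert ideal of a reflection group are
independent over its invariants. -/
theorem eq_zero_of_sum_mul_eq_zero {β : Basis ι ℂ E}
    {W : Subgroup (E ≃ₗ[ℂ] E)} [Fintype W]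
    (hW : Subgroup.closure {g : E ≃ₗ[ℂ] E | g ∈ W ∧ IsReflection g} = W)
    {κ : Type*} (F : Finset κ) (d : κ → ℕ) (h : κ → MvPolynomial ι ℂ)
    (hh : ∀ i, (h i).IsHomogeneous (d i))
    (hind : ∀ c : κ → ℂ, ∑ i ∈ F, C (c i) * h i ∈ hilbertIdeal β W → ∀ i ∈ F, c i = 0)
    (U : κ → MvPolynomial ι ℂ) (hU : ∀ i, U i ∈ invariantPoly β W)
    (hsum : ∑ i ∈ F, U i * h i = 0) : ∀ i ∈ F, U i = 0 := by
  classical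
  intro i hi
  suffices ∀ m, homogeneousComponent m (U i) = 0 by
    rw [← sum_homogeneousComponent (U i)]
    exact Finset.sum_eq_zero fun m _ => this m
  intro m
  have := eq_zero_of_sum_mul_eq_zero_of_isHomogeneous hW F d (m + d i) h (fun j _ => hh j) hind
    (fun j => if d j ≤ m + d i then homogeneousComponent (m + d i - d j) (U j) else 0)
    (fun j => ?_) (fun j _ => ?_) (fun j _ hj => if_neg (by omega)) ?_ i hi
  · simpa using this
  · split_ifs
    · exact homogeneousComponent_mem_invariantPoly (hU j) _
    · exact zero_mem _
  · split_ifs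
    · exact homogeneousComponent_isHomogeneous _ _
    · exact isHomogeneous_zero _ _ _
  · have h0 := congrArg (homogeneousComponent (m + d i)) hsum
    rw [map_sum, map_zero] at h0
    refine Eq.trans (Finset.sum_congr rfl fun j _ => ?_) h0
    rw [mul_comm (U j), homogeneousComponent_mul_of_isHomogeneous (hh j), ite_mul, zero_mul,
      mul_comm]

theorem linearIndependent_pullback {β : Basis ι ℂ E} {W : Subgroup (E ≃ₗ[ℂ] E)} [Fintype W]
    {κ : Type*} (h : κ → MvPolynomial ι ℂ)
    (hind : ∀ (F : Finset κ) (U : κ → MvPolynomial ι ℂ), (∀ i, U i ∈ invariantPoly β W) →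
      ∑ i ∈ F, U i * h i = 0 → ∀ i ∈ F, U i = 0) :
    LinearIndependent (MvPolynomial ι ℂ)
      (fun k => fun w : W => pullback β (w : E ≃ₗ[ℂ] E) (h k)) := by
  classical
  refine linearIndependent_iff'.2 fun F c hc => ?_
  have h₁ (w : W) : ∑ i ∈ F, pullback β (w : E ≃ₗ[ℂ] E) (c i) * h i = 0 := by
    have := congrArg (pullback β (w : E ≃ₗ[ℂ] E)) (congrFun hc w⁻¹)
    simpa [← pullback_mul, pullback_one] using this
  have h₂ (s : MvPolynomial ι ℂ) : ∀ i ∈ F, orbitSum β W (s * c i) = 0 := by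
    refine hind F (fun i => orbitSum β W (s * c i)) (fun i => orbitSum_mem _ _ _) ?_
    simp only [orbitSum_apply, Finset.sum_mul, map_mul]
    rw [Finset.sum_comm]
    refine Finset.sum_eq_zero fun w _ => ?_
    simp only [mul_assoc, ← Finset.mul_sum, h₁, mul_zero]
  intro i hi
  by_contra hci
  set N := ∏ w : W, pullback β (w : E ≃ₗ[ℂ] E) (c i) with hN
  have hNs : N = (∏ w ∈ Finset.univ.erase (1 : W), pullback β (w : E ≃ₗ[ℂ] E) (c i)) * c i := by
    rw [hN, ← Finset.prod_erase_mul _ _ (Finset.mem_univ (1 : W))]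
    simp [pullback_one]
  have hNmem : N ∈ invariantPoly β W := fun g hg => by
    simp only [hN, map_prod, ← pullback_mul]
    exact Fintype.prod_equiv (Equiv.mulRight (⟨g, hg⟩ : W)) _ _ fun _ => rfl
  have hN0 : N ≠ 0 := Finset.prod_ne_zero_iff.2 fun w _ =>
    (map_ne_zero_iff _ (pullback_injective β _)).2 hci
  have := h₂ (∏ w ∈ Finset.univ.erase (1 : W), pullback β (w : E ≃ₗ[ℂ] E) (c i)) i hi
  rw [← hNs, orbitSum_of_mem hNmem] at this
  refine mul_ne_zero (C_ne_zero.2 ?_) hN0 this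
  exact Nat.cast_ne_zero.2 Fintype.card_ne_zero

/-- The coinvariants of a reflection group `W` are spanned by at most `|W|` monomials. -/
theorem exists_monomials_spanning_coinvariants (β : Basis ι ℂ E)
    {W : Subgroup (E ≃ₗ[ℂ] E)} [Fintype W]
    (hW : Subgroup.closure {g : E ≃ₗ[ℂ] E | g ∈ W ∧ IsReflection g} = W) :
    ∃ (n : ℕ) (a : Fin n → ι →₀ ℕ), n ≤ Fintype.card W ∧
      ∀ P, ∃ c : Fin n → ℂ, P - ∑ k, C (c k) * monomial (a k) 1 ∈ hilbertIdeal β W := by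
  obtain ⟨κ, a, -, hspan, hli⟩ := exists_linearIndependent' ℂ
    (fun m : ι →₀ ℕ => Ideal.Quotient.mkₐ ℂ (hilbertIdeal β W) (monomial m 1))
  have hmk (F : Finset κ) (c : κ → ℂ) : Ideal.Quotient.mkₐ ℂ (hilbertIdeal β W)
      (∑ i ∈ F, C (c i) * monomial (a i) 1) =
      ∑ i ∈ F, c i • Ideal.Quotient.mkₐ ℂ (hilbertIdeal β W) (monomial (a i) 1) := by
    rw [map_sum]
    exact Finset.sum_congr rfl fun i _ => by rw [C_mul', map_smul]
  have hind := linearIndependent_pullback (β := β) (W := W)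
    (fun k => monomial (a k) (1 : ℂ)) fun F U hU hsum =>
      eq_zero_of_sum_mul_eq_zero hW F (fun k => (a k).degree) _
        (fun k => isHomogeneous_monomial _ rfl)
        (fun c hc => linearIndependent_iff'.1 hli F c (by
          rw [← Ideal.Quotient.eq_zero_iff_mem] at hc
          exact (hmk F c).symm.trans hc)) U hU hsum
  have : Finite κ := hind.finite
  have := Fintype.ofFinite κ
  have hcard := hind.fintype_card_le_finrank
  rw [Module.finrank_fintype_fun_eq_card] at hcard
  refine ⟨Fintype.card κ, a ∘ (Fintype.equivFin κ).symm, hcard, fun P => ?_⟩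
  have hP : Ideal.Quotient.mkₐ ℂ (hilbertIdeal β W) P ∈ Submodule.span ℂ (Set.range
      ((fun m : ι →₀ ℕ => Ideal.Quotient.mkₐ ℂ (hilbertIdeal β W) (monomial m 1)) ∘ a)) := by
    rw [hspan]
    rw [P.as_sum, map_sum]
    refine Submodule.sum_mem _ fun m _ => ?_
    rw [← mul_one (coeff m P), ← smul_eq_mul, ← smul_monomial, map_smul]
    exact Submodule.smul_mem _ _ (Submodule.subset_span ⟨m, rfl⟩)
  obtain ⟨c, hc⟩ := (Submodule.mem_span_range_iff_exists_fun ℂ).1 hP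
  refine ⟨c ∘ (Fintype.equivFin κ).symm, Ideal.Quotient.eq.1 ?_⟩
  refine Eq.trans (hc.symm.trans (hmk Finset.univ c).symm) ?_
  exact congrArg _ (Fintype.sum_equiv (Fintype.equivFin κ) _ _ fun k => by simp)

theorem orbitEval_mul_of_mem {β : Basis ι ℂ E} {W : Subgroup (E ≃ₗ[ℂ] E)} (v : E)
    {U : MvPolynomial ι ℂ} (hU : U ∈ invariantPoly β W) (P : MvPolynomial ι ℂ) :
    orbitEval β W v (P * U) = evalAt β v U • orbitEval β W v P := by
  funext w
  rw [Pi.smul_apply, orbitEval_apply, orbitEval_apply, map_mul, smul_eq_mul, mul_comm,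
    ← evalAt_pullback β w v U, hU w w.2]

theorem orbitEval_mem_span {β : Basis ι ℂ E} {W : Subgroup (E ≃ₗ[ℂ] E)} {κ : Type*} [Fintype κ]
    {a : κ → ι →₀ ℕ}
    (ha : ∀ P, ∃ c : κ → ℂ, P - ∑ k, C (c k) * monomial (a k) 1 ∈ hilbertIdeal β W)
    (v : E) (P : MvPolynomial ι ℂ) :
    orbitEval β W v P ∈
      Submodule.span ℂ (Set.range fun k => orbitEval β W v (monomial (a k) 1)) := by
  set S := Submodule.span ℂ (Set.range fun k => orbitEval β W v (monomial (a k) 1)) with hS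
  suffices ∀ n (P : MvPolynomial ι ℂ), P.IsHomogeneous n → orbitEval β W v P ∈ S by
    rw [← sum_homogeneousComponent P, map_sum]
    exact Submodule.sum_mem _ fun n _ => this n _ (homogeneousComponent_isHomogeneous n P)
  intro n
  induction n using Nat.strong_induction_on with
  | _ n ih =>
  intro P hP
  have hI (Q : MvPolynomial ι ℂ) (hQ : Q ∈ hilbertIdeal β W) :
      orbitEval β W v (homogeneousComponent n Q) ∈ S := by
    induction hQ using Submodule.closure_induction with
    | zero => simp
    | add x y _ _ hx hy =>
      rw [map_add, map_add]
      exact add_mem hx hy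
    | smul_mem s x hx =>
      rw [smul_eq_mul, ← sum_homogeneousComponent s, Finset.sum_mul, map_sum, map_sum]
      refine Submodule.sum_mem _ fun k _ => ?_
      rw [homogeneousComponent_mul_of_isHomogeneous (homogeneousComponent_isHomogeneous k s)]
      split_ifs with hk
      · rcases hk.eq_or_lt with rfl | hk
        · have h0 : coeff 0 x = 0 := hx.2
          simp [homogeneousComponent_zero, h0]
        · rw [orbitEval_mul_of_mem v (homogeneousComponent_mem_invariantPoly hx.1 _)]
          exact Submodule.smul_mem _ _ (ih k hk _ (homogeneousComponent_isHomogeneous k s))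
      · simp
  obtain ⟨c, hc⟩ := ha P
  have h := hI _ hc
  rw [map_sub, map_sub, homogeneousComponent_eq_self hP] at h
  refine (Submodule.sub_mem_iff_left S ?_).1 h
  rw [map_sum, map_sum]
  refine Submodule.sum_mem _ fun k _ => ?_
  rw [C_mul', map_smul, map_smul, homogeneousComponent_of_mem (isHomogeneous_monomial _ rfl)]
  refine Submodule.smul_mem _ _ ?_
  split_ifs
  · exact Submodule.subset_span ⟨k, rfl⟩
  · simp

theorem evalAt_apply_monomial {β : Basis ι ℂ E} {τ : E ≃ₗ[ℂ] E} {μ : ι → ℂ}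
    (hμ : ∀ i, τ (β i) = μ i • β i) (x : E) (m : ι →₀ ℕ) :
    evalAt β (τ x) (monomial m 1) = (m.prod fun i k => μ i ^ k) * evalAt β x (monomial m 1) := by
  have h (i : ι) : β.repr (τ x) i = μ i * β.repr x i := by
    classical
    conv_lhs => rw [← β.sum_repr x]
    simp only [map_sum, map_smul, hμ, Basis.repr_self, Finsupp.coe_finsetSum, Finset.sum_apply,
      Finsupp.smul_apply, Finsupp.single_apply, smul_eq_mul, mul_ite, ite_mul, zero_mul, mul_one, mul_zero,
      Finset.sum_ite_eq', Finset.mem_univ, if_true, mul_comm]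
  simp only [evalAt, aeval_monomial, h, mul_pow, Finsupp.prod_mul, map_one, one_mul]

/-- If functions `e k` spanning `X → ℂ`, at most `|X|` in number, are eigenvectors for a
permutation of `X`, then its number of fixed points is the sum of the eigenvalues. -/
theorem card_fixed_eq_sum {X κ : Type*} [Fintype X] [DecidableEq X] [Fintype κ]
    (e : κ → X → ℂ) (hspan : ⊤ ≤ Submodule.span ℂ (Set.range e))
    (hcard : Fintype.card κ ≤ Fintype.card X) (σ : Equiv.Perm X) (l : κ → ℂ)
    (h : ∀ k x, e k (σ x) = l k * e k x) :
    (Finset.card {x | σ x = x} : ℂ) = ∑ k, l k := by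
  classical
  have hle := finrank_range_le_card (R := ℂ) e
  rw [Set.finrank, top_le_iff.1 hspan, finrank_top, Module.finrank_fintype_fun_eq_card] at hle
  have hfin : Fintype.card κ = finrank ℂ (X → ℂ) := by
    rw [Module.finrank_fintype_fun_eq_card]
    exact le_antisymm hcard hle
  set b := basisOfTopLeSpanOfCardEqFinrank e hspan hfin with hb
  have hbe (k : κ) : b k = e k := by rw [hb, coe_basisOfTopLeSpanOfCardEqFinrank]
  have h₁ : LinearMap.trace ℂ (X → ℂ) (LinearMap.funLeft ℂ ℂ σ) = ∑ k, l k := by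
    rw [LinearMap.trace_eq_matrix_trace ℂ b]
    refine Finset.sum_congr rfl fun k _ => ?_
    have hk : LinearMap.funLeft ℂ ℂ σ (b k) = l k • b k := by
      funext x
      simp [LinearMap.funLeft_apply, hbe, h]
    rw [Matrix.diag_apply, LinearMap.toMatrix_apply, hk]
    simp
  rw [← h₁, LinearMap.trace_eq_matrix_trace ℂ (Pi.basisFun ℂ X), Finset.natCast_card_filter]
  refine Finset.sum_congr rfl fun x _ => ?_
  rw [Matrix.diag_apply, LinearMap.toMatrix_apply]
  simp [LinearMap.funLeft_apply, Pi.single_apply]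

theorem card_fixed_in_orbit {κ : Type*} [Fintype κ] {β : Basis ι ℂ E}
    {W : Subgroup (E ≃ₗ[ℂ] E)} [Fintype W] {a : κ → ι →₀ ℕ}
    (hcard : Fintype.card κ ≤ Fintype.card W)
    (ha : ∀ P, ∃ c : κ → ℂ, P - ∑ k, C (c k) * monomial (a k) 1 ∈ hilbertIdeal β W)
    {τ : E ≃ₗ[ℂ] E} {μ : ι → ℂ} (hμ : ∀ i, τ (β i) = μ i • β i) {v : E} (hv : v ∈ VReg W)
    (hstab : ∀ w : W, ∃ w' : W, τ ((w : E ≃ₗ[ℂ] E) v) = (w' : E ≃ₗ[ℂ] E) v) :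
    (Nat.card {w : W // τ ((w : E ≃ₗ[ℂ] E) v) = (w : E ≃ₗ[ℂ] E) v} : ℂ) =
      ∑ k, (a k).prod fun i m => μ i ^ m := by
  classical
  choose s hs using hstab
  have hsinj : Function.Injective s := fun w w' h =>
    eq_of_apply_eq_of_mem_VReg hv (τ.injective (by rw [hs, hs, h]))
  rw [← card_fixed_eq_sum (fun k => orbitEval β W v (monomial (a k) 1)) ?_ hcard
    (Equiv.ofBijective s (Finite.injective_iff_bijective.1 hsinj)) _ ?_]
  · rw [Nat.card_eq_fintype_card, Fintype.card_subtype]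
    congr 2
    ext w
    simp only [Finset.mem_filter, Finset.mem_univ, true_and, Equiv.ofBijective_apply, hs]
    exact ⟨eq_of_apply_eq_of_mem_VReg hv, fun h => by rw [h]⟩
  · intro f _
    obtain ⟨P, rfl⟩ := orbitEval_surjective β hv f
    exact orbitEval_mem_span ha v P
  · intro k w
    rw [Equiv.ofBijective_apply, orbitEval_apply, orbitEval_apply, ← hs,
      evalAt_apply_monomial hμ]

end Pullback

theorem exists_eigenbasis {τ : V ≃ₗ[ℂ] V} (hτ : IsOfFinOrder τ) :
    ∃ (n : ℕ) (β : Basis (Fin n) ℂ V) (μ : Fin n → ℂ), ∀ i, τ (β i) = μ i • β i := by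
  have hss : Module.End.IsSemisimple (τ : V →ₗ[ℂ] V) := by
    refine Module.End.isSemisimple_of_squarefree_aeval_eq_zero
      (p := Polynomial.X ^ orderOf τ - Polynomial.C 1) ?_ ?_
    · exact (Polynomial.separable_X_pow_sub_C 1
        (Nat.cast_ne_zero.2 hτ.orderOf_pos.ne') one_ne_zero).squarefree
    · have h : (τ : V →ₗ[ℂ] V) ^ orderOf τ = 1 := by
        have := congrArg (LinearEquiv.automorphismGroup.toLinearMapMonoidHom (R := ℂ) (M := V))
          (pow_orderOf_eq_one τ)
        rwa [map_pow, map_one] at this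
      simp [h]
  have hspan : ⊤ ≤ Submodule.span ℂ {x : V | ∃ μ : ℂ, τ x = μ • x} := by
    rw [← hss.iSup_eigenspace_eq_top]
    refine iSup_le fun μ x hx => Submodule.subset_span ⟨μ, ?_⟩
    exact Module.End.mem_eigenspace_iff.1 hx
  obtain ⟨κ, b, hb⟩ : ∃ (κ : Set V) (b : Basis κ ℂ V), ∀ i, ∃ μ : ℂ, τ (b i) = μ • b i :=
    ⟨_, Basis.ofSpan hspan, fun i => Basis.ofSpan_subset hspan ⟨i, rfl⟩⟩
  have := Module.Finite.finite_basis b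
  have := Fintype.ofFinite κ
  choose μ hμ using hb
  refine ⟨_, b.reindex (Fintype.equivFin _), μ ∘ (Fintype.equivFin _).symm, fun i => ?_⟩
  rw [Basis.reindex_apply]
  exact hμ _

/-- A `τ`-stable regular orbit contains a fixed point of `τ` as soon as one of them does. -/
theorem exists_fixed_mem_orbit {W : Subgroup (V ≃ₗ[ℂ] V)} [Finite W]
    (hW : Subgroup.closure {g : V ≃ₗ[ℂ] V | g ∈ W ∧ IsReflection g} = W)
    {τ : V ≃ₗ[ℂ] V} (hτfin : IsOfFinOrder τ)
    (hnorm : ∀ g : V ≃ₗ[ℂ] V, g ∈ W ↔ τ * g * τ⁻¹ ∈ W)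
    (hreg : ∃ v ∈ VReg W, τ v = v) {v : V} (hv : v ∈ VReg W)
    (hstab : ∀ w : W, ∃ w' : W, τ ((w : V ≃ₗ[ℂ] V) v) = (w' : V ≃ₗ[ℂ] V) v) :
    ∃ w ∈ W, τ (w v) = w v := by
  have := Fintype.ofFinite W
  obtain ⟨_, β, μ, hμ⟩ := exists_eigenbasis hτfin
  obtain ⟨n, a, hn, ha⟩ := exists_monomials_spanning_coinvariants β hW
  have hcard : Fintype.card (Fin n) ≤ Fintype.card W := by rwa [Fintype.card_fin]
  obtain ⟨x, hx, hτx⟩ := hreg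
  have hxstab (w : W) : ∃ w' : W, τ ((w : V ≃ₗ[ℂ] V) x) = (w' : V ≃ₗ[ℂ] V) x := by
    refine ⟨⟨τ * w * τ⁻¹, (hnorm w).1 w.2⟩, ?_⟩
    change _ = τ ((w : V ≃ₗ[ℂ] V) (τ.symm x))
    rw [τ.symm_apply_eq.2 hτx.symm]
  have h := (card_fixed_in_orbit hcard ha hμ hx hxstab).trans
    (card_fixed_in_orbit hcard ha hμ hv hstab).symm
  have h0 : Nat.card {w : W // τ ((w : V ≃ₗ[ℂ] V) x) = (w : V ≃ₗ[ℂ] V) x} ≠ 0 :=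
    Nat.card_ne_zero.2 ⟨⟨⟨1, hτx⟩⟩, inferInstance⟩
  rw [Nat.cast_inj.1 h] at h0
  obtain ⟨⟨w, hw⟩⟩ := (Nat.card_ne_zero.1 h0).1
  exact ⟨w, w.2, hw⟩

/-- If `τ` is regular and the `W`-orbit of `(v, v*) ∈ V_reg × V*` is `τ`-stable, then
some `W`-translate of `(v, v*)` consists of `τ`-fixed vectors. -/
theorem stmt4 (W : Subgroup (V ≃ₗ[ℂ] V)) [Finite W]
    (hW : Subgroup.closure {g : V ≃ₗ[ℂ] V | g ∈ W ∧ IsReflection g} = W)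
    (τ : V ≃ₗ[ℂ] V) (hτfin : IsOfFinOrder τ)
    (hnorm : ∀ g : V ≃ₗ[ℂ] V, g ∈ W ↔ τ * g * τ⁻¹ ∈ W)
    (hreg : ∃ v ∈ VReg W, τ v = v)
    (p : V × Module.Dual ℂ V) (hp : p.1 ∈ VReg W)
    (hstab : (fun q => pAct τ q) '' {q | ∃ w ∈ W, pAct w p = q} = {q | ∃ w ∈ W, pAct w p = q}) :
    ∃ w ∈ W, τ ((w : V ≃ₗ[ℂ] V) p.1) = w p.1 ∧ dAct τ (dAct w p.2) = dAct w p.2 := by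
  have hτ (w : V ≃ₗ[ℂ] V) (hw : w ∈ W) : ∃ u ∈ W, pAct u p = pAct τ (pAct w p) := by
    have : pAct τ (pAct w p) ∈ (fun q => pAct τ q) '' {q | ∃ w ∈ W, pAct w p = q} :=
      ⟨_, ⟨w, hw, rfl⟩, rfl⟩
    rwa [hstab] at this
  obtain ⟨w, hw, hfix⟩ := exists_fixed_mem_orbit hW hτfin hnorm hreg hp fun w => by
    obtain ⟨u, hu, h⟩ := hτ w w.2
    exact ⟨⟨u, hu⟩, (congrArg Prod.fst h).symm⟩
  obtain ⟨u, hu, h⟩ := hτ w hw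
  have huw : u = w :=
    congrArg Subtype.val (eq_of_apply_eq_of_mem_VReg hp (w := ⟨u, hu⟩) (w' := ⟨w, hw⟩)
      ((congrArg Prod.fst h).trans hfix))
  exact ⟨w, hw, hfix, (congrArg Prod.snd h).symm.trans (by rw [huw]; rfl)⟩
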